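/- Let X be a compact metrizable topological space and let μ be a centered Gaussian Borel probability measure on the separable Banach space C(X,ℝ) (i.e. the pushforward of μ under every continuous linear functional on C(X,ℝ) is a centered Gaussian distribution on ℝ) with ∫ ‖γ‖∞ dμ(γ) < ∞. Let T ∈ ℕ, T ≥ 1, and let μ^{⊗T} be the T-fold product of μ on C(X,ℝ)^T, modeling T independent draws γ_1,…,γ_T from μ. Then ∫ max_{x∈X} Σ_{t=1}^T γ_t(x) dμ^{⊗T}(γ) = √T · ∫ max_{x∈X} γ(x) dμ(γ). -/

import Mathlib

open MeasureTheory

/-- The maximum over a compact space `X` of a continuous function, written as a supremum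
(which is attained by compactness). -/
noncomputable def supVal {X : Type*} [TopologicalSpace X] (f : C(X, ℝ)) : ℝ := ⨆ x, f x

open ProbabilityTheory

theorem supVal_smul {X : Type*} [TopologicalSpace X] {c : ℝ} (hc : 0 ≤ c) (f : C(X, ℝ)) :
    supVal (c • f) = c * supVal f := by
  simp [supVal, Real.mul_iSup_of_nonneg hc]

theorem lipschitzWith_supVal {X : Type*} [TopologicalSpace X] [CompactSpace X] [Nonempty X] :
    LipschitzWith 1 (supVal : C(X, ℝ) → ℝ) := by
  refine LipschitzWith.of_le_add fun f g => ciSup_le fun x => ?_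
  have hle : g x ≤ supVal g := le_ciSup (isCompact_range g.continuous).bddAbove x
  have hdist := (abs_le.mp (ContinuousMap.dist_apply_le_dist (f := f) (g := g) x)).2
  linarith

theorem charFunDual_of_map_eq_gaussianReal {E : Type*} [NormedAddCommGroup E] [NormedSpace ℝ E]
    [MeasurableSpace E] [BorelSpace E] {μ : Measure E} {L : E →L[ℝ] ℝ} {v : NNReal}
    (h : Measure.map L μ = gaussianReal 0 v) (u : ℝ) :
    charFunDual μ (u • L) = Complex.exp (-(v * u ^ 2 / 2)) := by
  rw [← charFun_map_eq_charFunDual_smul, h, charFun_gaussianReal]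
  congr 1
  push_cast
  ring

/-- The sum of `T` independent copies of a centered Gaussian vector has the law of `√T` times
that vector. -/
theorem map_sum_pi_eq_map_sqrt_smul {E : Type*} [NormedAddCommGroup E] [NormedSpace ℝ E]
    [CompleteSpace E] [SecondCountableTopology E] [MeasurableSpace E] [BorelSpace E]
    (μ : Measure E) [IsProbabilityMeasure μ]
    (hgauss : ∀ ℓ : E →L[ℝ] ℝ, ∃ v : NNReal, Measure.map ℓ μ = gaussianReal 0 v) (T : ℕ) :
    (Measure.pi fun _ : Fin T => μ).map (fun γ => ∑ t, γ t)
      = μ.map (fun γ => Real.sqrt T • γ) := by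
  have hsum : Measurable fun γ : Fin T → E => ∑ t, γ t := by fun_prop
  have hsmul : Measurable fun γ : E => Real.sqrt T • γ := by fun_prop
  have := Measure.isProbabilityMeasure_map (μ := Measure.pi fun _ : Fin T => μ) hsum.aemeasurable
  have := Measure.isProbabilityMeasure_map (μ := μ) hsmul.aemeasurable
  refine Measure.ext_of_charFunDual (funext fun L => ?_)
  obtain ⟨v, hv⟩ := hgauss L
  have hmap : charFunDual (μ.map fun γ => Real.sqrt T • γ) L
      = charFunDual μ (Real.sqrt T • L) := by
    rw [charFunDual_apply, charFunDual_apply, integral_map hsmul.aemeasurable (by fun_prop)]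
    simp
  have hone := charFunDual_of_map_eq_gaussianReal hv 1
  rw [one_smul] at hone
  have hT : ((Real.sqrt T : ℝ) : ℂ) ^ 2 = T := by
    rw [← Complex.ofReal_pow, Real.sq_sqrt T.cast_nonneg, Complex.ofReal_natCast]
  rw [charFunDual_map_sum_pi_eq_prod, hmap, charFunDual_of_map_eq_gaussianReal hv, hT]
  simp only [Finset.prod_const, Finset.card_univ, Fintype.card_fin, Pi.pow_apply, hone]
  rw [← Complex.exp_nat_mul]
  congr 1
  push_cast
  ring

/-- for a centered Gaussian Borel probability measure `μ` on `C(X,ℝ)`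
(every continuous linear functional pushes `μ` forward to a centered Gaussian on `ℝ`)
with `∫ ‖γ‖∞ dμ < ∞`, the expected maximum of a sum of `T` i.i.d. draws scales as `√T`:
`∫ max_x Σ_t γ_t(x) dμ^{⊗T}(γ) = √T · ∫ max_x γ(x) dμ(γ)`. -/
theorem gaussian_sum_expected_sup {X : Type*} [TopologicalSpace X] [CompactSpace X]
    [TopologicalSpace.MetrizableSpace X] [Nonempty X]
    [MeasurableSpace C(X, ℝ)] [BorelSpace C(X, ℝ)]
    (μ : Measure C(X, ℝ)) [IsProbabilityMeasure μ]
    (hint : Integrable (fun γ : C(X, ℝ) => ‖γ‖) μ)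
    (hgauss : ∀ ℓ : C(X, ℝ) →L[ℝ] ℝ, ∃ v : NNReal,
      Measure.map ℓ μ = ProbabilityTheory.gaussianReal 0 v)
    (T : ℕ) (hT : 1 ≤ T) :
    (∫ γ : Fin T → C(X, ℝ), supVal (∑ t, γ t) ∂(Measure.pi fun _ : Fin T => μ))
      = Real.sqrt T * ∫ γ : C(X, ℝ), supVal γ ∂μ := by
  have hcont : Continuous (supVal : C(X, ℝ) → ℝ) := lipschitzWith_supVal.continuous
  calc ∫ γ : Fin T → C(X, ℝ), supVal (∑ t, γ t) ∂(Measure.pi fun _ : Fin T => μ)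
      = ∫ γ, supVal γ ∂((Measure.pi fun _ : Fin T => μ).map fun γ => ∑ t, γ t) :=
        (integral_map (by fun_prop) hcont.aestronglyMeasurable).symm
    _ = ∫ γ : C(X, ℝ), supVal (Real.sqrt T • γ) ∂μ := by
        rw [map_sum_pi_eq_map_sqrt_smul μ hgauss,
          integral_map (by fun_prop) hcont.aestronglyMeasurable]
    _ = Real.sqrt T * ∫ γ : C(X, ℝ), supVal γ ∂μ := by
        simp_rw [supVal_smul (Real.sqrt_nonneg _), integral_const_mul]
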